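/- On the open set U = { (x,y,z) ∈ ℝ³ : |z| < π/2 } let Y₁(x,y,z) = (1, tan z, 0), Y₂(x,y,z) = (0, 0, cos² z), and Y₃(x,y,z) = (0, -1, 0) (the feedback-transformed unicycle fields). Then at every point p ∈ U: [Y₁,Y₂](p) = Y₃(p), [Y₁,Y₃](p) = 0, and [Y₂,Y₃](p) = 0. Hence the Lie algebra generated by Y₁, Y₂ on U is nilpotent of order 2: every iterated Lie bracket of Y₁, Y₂ of order greater than 2 vanishes on U. -/

import Mathlib

/-- The region `|z| < π/2` of `ℝ³` on which the unicycle feedback transformation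
is valid. -/
def uniRegion : Set (Fin 3 → ℝ) := {p | |p 2| < Real.pi / 2}

/-- The first feedback-transformed unicycle field: `Y₁(x,y,z) = (1, tan z, 0)`. -/
noncomputable def uniY1 : (Fin 3 → ℝ) → (Fin 3 → ℝ) := fun p => ![1, Real.tan (p 2), 0]

/-- The second feedback-transformed unicycle field: `Y₂(x,y,z) = (0, 0, cos² z)`. -/
noncomputable def uniY2 : (Fin 3 → ℝ) → (Fin 3 → ℝ) := fun p => ![0, 0, Real.cos (p 2) ^ 2]

/-- The third field: `Y₃(x,y,z) = (0, -1, 0)`. -/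
def uniY3 : (Fin 3 → ℝ) → (Fin 3 → ℝ) := fun _ => ![0, -1, 0]

/-- Iterated Lie brackets of `Y₁, Y₂` together with their order: `Y₁, Y₂` have order
`1`, and the bracket of brackets of orders `a` and `b` has order `a + b`. -/
inductive UniBracket : ((Fin 3 → ℝ) → (Fin 3 → ℝ)) → ℕ → Prop
  | base1 : UniBracket uniY1 1
  | base2 : UniBracket uniY2 1
  | bracket {V W : (Fin 3 → ℝ) → (Fin 3 → ℝ)} {a b : ℕ} :
      UniBracket V a → UniBracket W b →
      UniBracket (VectorField.lieBracket ℝ V W) (a + b)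

theorem uni_open : IsOpen uniRegion := by
  unfold uniRegion
  exact isOpen_lt (by fun_prop) (by fun_prop)

theorem uni_cos {p : Fin 3 → ℝ} (hp : p ∈ uniRegion) : Real.cos (p 2) ≠ 0 := by
  have h := abs_lt.1 (show |p 2| < Real.pi / 2 from hp)
  exact (Real.cos_pos_of_mem_Ioo ⟨by linarith [h.1], h.2⟩).ne'

theorem uni_d1 {p : Fin 3 → ℝ} (hp : p ∈ uniRegion) (v : Fin 3 → ℝ) :
    fderiv ℝ uniY1 p v = ![0, v 2 / Real.cos (p 2) ^ 2, 0] := by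
  have hz : HasFDerivAt (fun q : Fin 3 → ℝ => q 2)
      (ContinuousLinearMap.proj (R := ℝ) (φ := fun _ : Fin 3 => ℝ) 2) p :=
    hasFDerivAt_apply 2 p
  have ht := (Real.hasDerivAt_tan (uni_cos hp)).comp_hasFDerivAt p hz
  have h : HasFDerivAt uniY1 (ContinuousLinearMap.pi
      ![0, (1 / Real.cos (p 2) ^ 2) •
        (ContinuousLinearMap.proj (R := ℝ) (φ := fun _ : Fin 3 => ℝ) 2), 0]) p := by
    rw [hasFDerivAt_pi']
    intro i
    fin_cases i
    · exact hasFDerivAt_const (1 : ℝ) p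
    · exact ht
    · exact hasFDerivAt_const (0 : ℝ) p
  rw [h.fderiv]
  ext i
  fin_cases i <;> simp [div_eq_inv_mul]

theorem uni_d2 (p v : Fin 3 → ℝ) :
    fderiv ℝ uniY2 p v = ![0, 0, (-2 * Real.cos (p 2) * Real.sin (p 2)) * v 2] := by
  have hz : HasFDerivAt (fun q : Fin 3 → ℝ => q 2)
      (ContinuousLinearMap.proj (R := ℝ) (φ := fun _ : Fin 3 => ℝ) 2) p :=
    hasFDerivAt_apply 2 p
  have ht := ((Real.hasDerivAt_cos (p 2)).pow 2).comp_hasFDerivAt p hz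
  have h : HasFDerivAt uniY2 (ContinuousLinearMap.pi
      ![0, 0, (((2 : ℕ) : ℝ) * Real.cos (p 2) ^ (2 - 1) * -Real.sin (p 2)) •
        (ContinuousLinearMap.proj (R := ℝ) (φ := fun _ : Fin 3 => ℝ) 2)]) p := by
    rw [hasFDerivAt_pi']
    intro i
    fin_cases i
    · exact hasFDerivAt_const (0 : ℝ) p
    · exact hasFDerivAt_const (0 : ℝ) p
    · exact ht
  rw [h.fderiv]
  ext i
  fin_cases i <;> simp

theorem uni_dc {V : (Fin 3 → ℝ) → (Fin 3 → ℝ)} {w : Fin 3 → ℝ}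
    (h : ∀ p ∈ uniRegion, V p = w) {p : Fin 3 → ℝ} (hp : p ∈ uniRegion) :
    fderiv ℝ V p = 0 := by
  have : V =ᶠ[nhds p] fun _ => w := by
    filter_upwards [uni_open.mem_nhds hp] with q hq using h q hq
  rw [this.fderiv_eq]
  simp

theorem uni_12 {p : Fin 3 → ℝ} (hp : p ∈ uniRegion) :
    VectorField.lieBracket ℝ uniY1 uniY2 p = uniY3 p := by
  have hc := uni_cos hp
  rw [VectorField.lieBracket, uni_d1 hp, uni_d2]
  ext i
  fin_cases i <;> simp [uniY1, uniY2, uniY3, hc]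

theorem uni_inv {V : (Fin 3 → ℝ) → (Fin 3 → ℝ)} {m : ℕ} (h : UniBracket V m) :
    1 ≤ m ∧ (∀ p ∈ uniRegion, fderiv ℝ V p ![0, -1, 0] = 0) ∧
    ((m = 1 ∧ (V = uniY1 ∨ V = uniY2)) ∨
      (2 ≤ m ∧ ∃ c : ℝ, (∀ p ∈ uniRegion, V p = c • ![0, -1, 0]) ∧ (3 ≤ m → c = 0))) := by
  induction h with
  | base1 =>
    refine ⟨le_rfl, fun p hp => ?_, Or.inl ⟨rfl, Or.inl rfl⟩⟩
    rw [uni_d1 hp]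
    ext i
    fin_cases i <;> simp
  | base2 =>
    refine ⟨le_rfl, fun p hp => ?_, Or.inl ⟨rfl, Or.inr rfl⟩⟩
    rw [uni_d2]
    ext i
    fin_cases i <;> simp
  | @bracket V W a b _ _ ihV ihW =>
    obtain ⟨ha, dV, hV⟩ := ihV
    obtain ⟨hb, dW, hW⟩ := ihW
    have key : ∃ c : ℝ, (∀ p ∈ uniRegion,
        VectorField.lieBracket ℝ V W p = c • ![0, -1, 0]) ∧ (3 ≤ a + b → c = 0) := by
      rcases hV with ⟨ha1, hV⟩ | ⟨ha2, c, hV, -⟩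
      · rcases hW with ⟨hb1, hW⟩ | ⟨hb2, d, hW, -⟩
        · rcases hV with rfl | rfl <;> rcases hW with rfl | rfl
          · exact ⟨0, fun p _ => by simp, fun _ => rfl⟩
          · exact ⟨1, fun p hp => by rw [uni_12 hp, one_smul]; rfl, fun _ => by omega⟩
          · exact ⟨-1, fun p hp => by
              rw [VectorField.lieBracket_swap, uni_12 hp, neg_one_smul]; rfl, fun _ => by omega⟩
          · exact ⟨0, fun p _ => by simp, fun _ => rfl⟩
        · refine ⟨0, fun p hp => ?_, fun _ => rfl⟩
          rw [VectorField.lieBracket, uni_dc hW hp, hW p hp, map_smul, dV p hp]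
          simp
      · refine ⟨0, fun p hp => ?_, fun _ => rfl⟩
        rw [VectorField.lieBracket, uni_dc hV hp, hV p hp, map_smul, dW p hp]
        simp
    obtain ⟨c, hc, hc0⟩ := key
    refine ⟨by omega, fun p hp => ?_, Or.inr ⟨by omega, c, hc, hc0⟩⟩
    rw [uni_dc hc hp]
    rfl

/-- On the region `|z| < π/2`, the feedback-transformed unicycle fields satisfy
`[Y₁,Y₂] = Y₃`, `[Y₁,Y₃] = 0`, `[Y₂,Y₃] = 0`; hence the Lie algebra they generate is
nilpotent of order 2: every iterated bracket of order `> 2` vanishes on the region. -/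
theorem unicycle_feedback_nilpotent :
    (∀ p ∈ uniRegion, VectorField.lieBracket ℝ uniY1 uniY2 p = uniY3 p) ∧
    (∀ p ∈ uniRegion, VectorField.lieBracket ℝ uniY1 uniY3 p = 0) ∧
    (∀ p ∈ uniRegion, VectorField.lieBracket ℝ uniY2 uniY3 p = 0) ∧
    (∀ (V : (Fin 3 → ℝ) → (Fin 3 → ℝ)) (m : ℕ), UniBracket V m → 2 < m →
      ∀ p ∈ uniRegion, V p = 0) := by
  have h3 : ∀ p ∈ uniRegion, uniY3 p = ![0, -1, 0] := fun _ _ => rfl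
  refine ⟨fun p hp => uni_12 hp, fun p hp => ?_, fun p hp => ?_, fun V m h hm p hp => ?_⟩
  · rw [VectorField.lieBracket, uni_dc h3 hp, h3 p hp, (uni_inv .base1).2.1 p hp]
    simp
  · rw [VectorField.lieBracket, uni_dc h3 hp, h3 p hp, (uni_inv .base2).2.1 p hp]
    simp
  · obtain ⟨-, -, ⟨h1, -⟩ | ⟨-, c, hc, hc0⟩⟩ := uni_inv h
    · omega
    · rw [hc p hp, hc0 hm, zero_smul]
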